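/- arXiv:1708.05523 — 3 statements merged into one kernel-verified Lean document; each statement's English description precedes it below -/
import Mathlib

section
/- Let α be a positive root of the subsystem Φ_P (i.e. α ∈ Φ⁺ with coefficient of α_P equal to 0), and let β, β′ ∈ Ψ be orthogonal roots. Then: (i) if β + α ∈ Φ, then β′ + α ∉ Φ; (ii) if β − α ∈ Ψ, then β′ − α ∉ Ψ. -/
open scoped RealInnerProductSpace
open Classical

noncomputable section

variable (V : Type) [NormedAddCommGroup V] [InnerProductSpace ℝ V]

/-- The reflection determined by a vector `α` (the identity map if `α = 0`),
as a linear endomorphism:  `x ↦ x - (2⟪x,α⟫/⟪α,α⟫) • α`. -/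
def reflMap (α : V) : V →ₗ[ℝ] V where
  toFun x := x - (2 * ⟪x, α⟫ / ⟪α, α⟫) • α
  map_add' x y := by
    simp only [inner_add_left]
    rw [show 2 * (⟪x, α⟫ + ⟪y, α⟫) / ⟪α, α⟫
        = 2 * ⟪x, α⟫ / ⟪α, α⟫ + 2 * ⟪y, α⟫ / ⟪α, α⟫ by ring, add_smul]
    abel
  map_smul' c x := by
    simp only [real_inner_smul_left, RingHom.id_apply, smul_sub]
    rw [show 2 * (c * ⟪x, α⟫) / ⟪α, α⟫ = c * (2 * ⟪x, α⟫ / ⟪α, α⟫) by ring,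
      mul_smul]

lemma reflMap_apply (α x : V) :
    reflMap V α x = x - (2 * ⟪x, α⟫ / ⟪α, α⟫) • α := rfl

lemma reflMap_involutive (α : V) : ∀ x, reflMap V α (reflMap V α x) = x := by
  intro x
  by_cases h : (⟪α, α⟫ : ℝ) = 0
  · have h0 : α = 0 := inner_self_eq_zero.mp h
    simp [reflMap_apply, h0]
  · rw [reflMap_apply, reflMap_apply, inner_sub_left, real_inner_smul_left,
      div_mul_cancel₀ _ h]
    rw [show ⟪x, α⟫ - 2 * ⟪x, α⟫ = -⟪x, α⟫ by ring]
    rw [show 2 * -⟪x, α⟫ / ⟪α, α⟫ = -(2 * ⟪x, α⟫ / ⟪α, α⟫) by ring, neg_smul]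
    abel

/-- The reflection determined by a vector `α`, as a linear automorphism of `V`. -/
def sref (α : V) : V ≃ₗ[ℝ] V :=
  { reflMap V α with
    invFun := reflMap V α
    left_inv := reflMap_involutive V α
    right_inv := reflMap_involutive V α }

lemma sref_apply (α x : V) :
    sref V α x = x - (2 * ⟪x, α⟫ / ⟪α, α⟫) • α := rfl

variable {V}

/-- The coroot `α^∨ = 2α/⟪α,α⟫` associated with a root `α`, under the identification of the
coweight space with `V` given by the inner product. -/
def coroot (α : V) : V := (2 / ⟪α, α⟫) • α

/-- The dimension of the `(-1)`-eigenspace of a linear automorphism. -/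
def lamEig (σ : V ≃ₗ[ℝ] V) : ℕ :=
  Module.finrank ℝ (Module.End.eigenspace (σ : V →ₗ[ℝ] V) (-1))

/-- The action `s_α ∘ σ` of a simple reflection on an involution: `s_α σ` if `s_α` and `σ`
commute, and `s_α σ s_α` otherwise. -/
def circAct (α : V) (σ : V ≃ₗ[ℝ] V) : V ≃ₗ[ℝ] V :=
  if sref V α * σ = σ * sref V α then sref V α * σ else sref V α * σ * sref V α

/-- A set of pairwise orthogonal vectors. -/
def OrthSet (S : Finset V) : Prop :=
  (↑S : Set V).Pairwise fun a b => ⟪a, b⟫ = 0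

/-- The product `σ_S` of the (commuting) reflections in the elements of an orthogonal set
`S`. -/
def sigmaOf (S : Finset V) : V ≃ₗ[ℝ] V :=
  (S.toList.map (sref V)).prod

variable (V)

/-- A finite crystallographic reduced root system in the Euclidean space `V`,
together with a fixed choice of simple roots. -/
structure RSD where
  /-- The set of roots. -/
  Φ : Finset V
  /-- The set of simple roots. -/
  Δ : Finset V
  nonzero : (0 : V) ∉ Φ
  span_top : Submodule.span ℝ (Φ : Set V) = ⊤
  reduced : ∀ α ∈ Φ, ∀ c : ℝ, c • α ∈ Φ → c = 1 ∨ c = -1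
  crystal : ∀ α ∈ Φ, ∀ β ∈ Φ, ∃ n : ℤ, (n : ℝ) = 2 * ⟪β, α⟫ / ⟪α, α⟫
  reflClosed : ∀ α ∈ Φ, ∀ β ∈ Φ, sref V α β ∈ Φ
  Δ_sub : Δ ⊆ Φ
  Δ_indep : LinearIndependent ℝ (fun x : (Δ : Set V) => (x : V))
  Δ_base : ∀ α ∈ Φ, (∃ c : V → ℕ, α = ∑ γ ∈ Δ, (c γ : ℝ) • γ) ∨
      (∃ c : V → ℕ, -α = ∑ γ ∈ Δ, (c γ : ℝ) • γ)

namespace RSD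

variable {V}
variable (D : RSD V)

/-- The set of positive roots. -/
def Pos : Set V :=
  {α | α ∈ D.Φ ∧ ∃ c : V → ℕ, α = ∑ γ ∈ D.Δ, (c γ : ℝ) • γ}

/-- The set of negative roots. -/
def Neg : Set V := {α | -α ∈ D.Pos}

/-- The Weyl group, as the subgroup of `GL(V)` generated by the simple reflections. -/
def W : Subgroup (V ≃ₗ[ℝ] V) := Subgroup.closure ((fun γ => sref V γ) '' ↑D.Δ)

/-- The length of `w`: the least number of simple reflections needed to write `w` as a
product of simple reflections. -/
def length (w : V ≃ₗ[ℝ] V) : ℕ :=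
  sInf {n | ∃ l : List V, l.length = n ∧ (∀ γ ∈ l, γ ∈ D.Δ) ∧ w = (l.map (sref V)).prod}

/-- The Bruhat order on the Weyl group: `u ≤ v` iff `v` is obtained from `u` by successively
multiplying by reflections, each time increasing the length. -/
def ble (u v : V ≃ₗ[ℝ] V) : Prop :=
  Relation.ReflTransGen
    (fun x y => (∃ β ∈ D.Φ, y = sref V β * x) ∧ D.length x < D.length y) u v

/-- The strict Bruhat order. -/
def blt (u v : V ≃ₗ[ℝ] V) : Prop := D.ble u v ∧ u ≠ v

/-- The dominance order: `y - x` is a nonnegative integer combination of simple roots. -/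
def dom (x y : V) : Prop := ∃ c : V → ℕ, y - x = ∑ γ ∈ D.Δ, (c γ : ℝ) • γ

/-- The dominance order on coweights: `y - x` is a nonnegative integer combination of simple
coroots. -/
def cdom (x y : V) : Prop := ∃ c : V → ℕ, y - x = ∑ γ ∈ D.Δ, (c γ : ℝ) • coroot γ

/-- The length `L(σ) = (ℓ(σ) + λ(σ))/2` of an involution `σ`, where `λ(σ)` is the dimension
of the `(-1)`-eigenspace of `σ`. -/
def Linv (σ : V ≃ₗ[ℝ] V) : ℚ :=
  ((D.length σ : ℚ) + (lamEig σ : ℚ)) / 2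

end RSD

/-- A finite irreducible crystallographic reduced root system, with a fixed choice of simple
roots and a marked simple root `αP` whose coefficient in the highest root `θ` equals `1`
(the cominuscule case). -/
structure MRSD extends RSD V where
  irred : ¬ ∃ A B : Set V, A.Nonempty ∧ B.Nonempty ∧ A ∪ B = ↑Φ ∧
      ∀ α ∈ A, ∀ β ∈ B, ⟪α, β⟫ = 0
  /-- The marked simple root. -/
  αP : V
  αP_mem : αP ∈ Δ
  /-- The highest root. -/
  θ : V
  θ_mem : θ ∈ Φ
  θ_high : ∀ α ∈ Φ, ∃ c : V → ℕ, θ - α = ∑ γ ∈ Δ, (c γ : ℝ) • γ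
  θ_coeff : ∃ c : V → ℕ, (θ = ∑ γ ∈ Δ, (c γ : ℝ) • γ) ∧ c αP = 1

namespace MRSD

variable {V}
variable (M : MRSD V)

/-- The set `Ψ` of positive roots in which the marked simple root `αP` has coefficient `1`. -/
def Psi : Set V :=
  {α | α ∈ M.Φ ∧ ∃ c : V → ℕ, (α = ∑ γ ∈ M.Δ, (c γ : ℝ) • γ) ∧ c M.αP = 1}

/-- The set of positive roots of the subsystem `Φ_P`, i.e. the positive roots in which the
marked simple root `αP` has coefficient `0`. -/
def PosP : Set V :=
  {α | α ∈ M.Φ ∧ ∃ c : V → ℕ, (α = ∑ γ ∈ M.Δ, (c γ : ℝ) • γ) ∧ c M.αP = 0}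

/-- The parabolic subgroup `W_P` generated by the simple reflections in `Δ ∖ {αP}`. -/
def WP : Subgroup (V ≃ₗ[ℝ] V) :=
  Subgroup.closure ((fun γ => sref V γ) '' ↑(M.Δ.erase M.αP))

/-- The inversion set `Φ⁺(v) = {α ∈ Φ⁺ : v(α) ∈ Φ⁻}`. -/
def InvSet (v : V ≃ₗ[ℝ] V) : Set V := {α | α ∈ M.Pos ∧ v α ∈ M.Neg}

/-- `v` belongs to `W^P`: it lies in `W` and has minimal length in its coset `v W_P`. -/
def IsMinRep (v : V ≃ₗ[ℝ] V) : Prop :=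
  v ∈ M.W ∧ ∀ u, u ∈ M.W → v⁻¹ * u ∈ M.WP → M.length v ≤ M.length u

/-- `μ` is the minimal length representative `[w]^P` of the coset `w W_P`. -/
def IsMinRepOf (μ w : V ≃ₗ[ℝ] V) : Prop :=
  (μ ∈ M.W ∧ w⁻¹ * μ ∈ M.WP) ∧
    ∀ u, u ∈ M.W → w⁻¹ * u ∈ M.WP → M.length μ ≤ M.length u

/-- The subset `Φ_S = {α ∈ Φ : σ_S(α) = -α}` determined by an orthogonal set of roots `S`. -/
def PhiSet (S : Finset V) : Set V := {α | α ∈ M.Φ ∧ sigmaOf S α = -α}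

/-- A root is long if its squared length is maximal among the roots. -/
def IsLong (α : V) : Prop := ∀ β ∈ M.Φ, ⟪β, β⟫ ≤ ⟪α, α⟫

/-- Admissible pair: `v ∈ W^P`, `S ⊆ Ψ` a set of pairwise orthogonal roots with
`v(S) ⊆ Φ⁻`. -/
def Admissible (v : V ≃ₗ[ℝ] V) (S : Finset V) : Prop :=
  M.IsMinRep v ∧ (↑S : Set V) ⊆ M.Psi ∧ OrthSet S ∧ ∀ β ∈ S, v β ∈ M.Neg

/-- The length `L(v,S) = (ℓ(σ_{v(S)}) + |S|)/2` of an admissible pair `(v,S)`. -/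
def pairL (v : V ≃ₗ[ℝ] V) (S : Finset V) : ℚ :=
  ((M.length (sigmaOf (S.image fun x => v x)) : ℚ) + (S.card : ℚ)) / 2

end MRSD

namespace MRSD

variable {V}
variable (M : MRSD V)

/-- There is a linear functional reading off the coefficient of the marked simple root. -/
lemma exists_coeff : ∃ f : V →ₗ[ℝ] ℝ, ∀ c : V → ℕ,
    f (∑ γ ∈ M.Δ, (c γ : ℝ) • γ) = c M.αP := by
  have hΔ : LinearIndepOn ℝ id (M.Δ : Set V) := M.Δ_indep
  let b := Module.Basis.extend hΔ
  refine ⟨b.constr ℝ fun i => if (i : V) = M.αP then 1 else 0, fun c => ?_⟩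
  have hb : ∀ γ ∈ M.Δ, b.constr ℝ (fun i => if (i : V) = M.αP then (1 : ℝ) else 0) γ =
      if γ = M.αP then 1 else 0 := by
    intro γ hγ
    have h := b.constr_basis ℝ (fun i => if (i : V) = M.αP then (1 : ℝ) else 0)
      ⟨γ, Module.Basis.subset_extend hΔ hγ⟩
    rwa [Module.Basis.extend_apply_self] at h
  rw [map_sum, Finset.sum_congr rfl fun γ hγ => by rw [map_smul, hb γ hγ]]
  simp [M.αP_mem]

variable {M} {f : V →ₗ[ℝ] ℝ}

lemma coeff_le_one (hf : ∀ c : V → ℕ, f (∑ γ ∈ M.Δ, (c γ : ℝ) • γ) = c M.αP)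
    {α : V} (hα : α ∈ M.Φ) : f α ≤ 1 := by
  obtain ⟨c, hc⟩ := M.θ_high α hα
  obtain ⟨d, hd, hd1⟩ := M.θ_coeff
  have hθ : f M.θ = 1 := by rw [hd, hf, hd1, Nat.cast_one]
  have h : f M.θ - f α = c M.αP := by rw [← map_sub, hc, hf]
  have : (0 : ℝ) ≤ c M.αP := Nat.cast_nonneg _
  linarith

/-- Two roots with coefficient `1` at the marked simple root form a non-obtuse angle. -/
lemma inner_nonneg_of_coeff_eq_one (hle : ∀ γ ∈ M.Φ, f γ ≤ 1) {β γ : V}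
    (hβ : β ∈ M.Φ) (hγ : γ ∈ M.Φ) (hfβ : f β = 1) (hfγ : f γ = 1) : 0 ≤ ⟪β, γ⟫ := by
  by_contra! hneg
  have hpos : 0 < ⟪γ, γ⟫ :=
    real_inner_self_pos.mpr fun h => M.nonzero (h ▸ hγ)
  have h := hle _ (M.reflClosed γ hγ β hβ)
  rw [sref_apply, map_sub, map_smul, hfβ, hfγ, smul_eq_mul, mul_one] at h
  have : 2 * ⟪β, γ⟫ / ⟪γ, γ⟫ < 0 := div_neg_of_neg_of_pos (by linarith) hpos
  linarith

/-- If `β`, `β'` are orthogonal roots with coefficient `1` at the marked simple root, then no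
root `α` with coefficient `0` can be added to both. -/
lemma add_notMem_of_inner_eq_zero (hle : ∀ γ ∈ M.Φ, f γ ≤ 1) {α β β' : V}
    (hα : α ∈ M.Φ) (hβ : β ∈ M.Φ) (hβ' : β' ∈ M.Φ)
    (hfα : f α = 0) (hfβ : f β = 1) (hfβ' : f β' = 1) (horth : ⟪β, β'⟫ = 0)
    (h : β + α ∈ M.Φ) : β' + α ∉ M.Φ := by
  intro h'
  have hadd : f (β + α) = 1 := by rw [map_add, hfβ, hfα, add_zero]
  have hadd' : f (β' + α) = 1 := by rw [map_add, hfβ', hfα, add_zero]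
  have hpos : 0 < ⟪α, α⟫ :=
    real_inner_self_pos.mpr fun h0 => M.nonzero (h0 ▸ hα)
  have h1 := inner_nonneg_of_coeff_eq_one hle hβ h' hfβ hadd'
  have h2 := inner_nonneg_of_coeff_eq_one hle h hβ' hadd hfβ'
  have h3 := inner_nonneg_of_coeff_eq_one hle h (M.reflClosed α hα _ h') hadd
    (by rw [sref_apply, map_sub, map_smul, hfα, smul_zero, sub_zero, hadd'])
  rw [sref_apply] at h3
  simp only [inner_add_left, inner_add_right, inner_sub_right, real_inner_smul_right,
    horth, real_inner_comm β' α] at h1 h2 h3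
  have hn : 2 * (⟪β', α⟫ + ⟪α, α⟫) / ⟪α, α⟫ = 2 * (⟪β', α⟫ / ⟪α, α⟫) + 2 := by
    field_simp
  have hm : 0 ≤ ⟪β', α⟫ / ⟪α, α⟫ :=
    div_nonneg (by linarith [real_inner_comm β' α]) hpos.le
  have hmα : ⟪β', α⟫ / ⟪α, α⟫ * ⟪α, α⟫ = ⟪β', α⟫ := div_mul_cancel₀ _ hpos.ne'
  have hsymm := real_inner_comm β' α
  rw [hn] at h3
  nlinarith [mul_nonneg hm (show 0 ≤ ⟪β, α⟫ by linarith)]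

end MRSD

/-- Let `α` be a positive root of `Φ_P` (coefficient of `α_P` equal to 0)
and `β, β' ∈ Ψ` orthogonal roots.  Then (i) `β + α ∈ Φ → β' + α ∉ Φ`;
(ii) `β - α ∈ Ψ → β' - α ∉ Ψ`. -/
theorem statement13 {V : Type} [NormedAddCommGroup V] [InnerProductSpace ℝ V]
    [FiniteDimensional ℝ V]
    (M : MRSD V) (α β β' : V) (hα : α ∈ M.PosP)
    (hβ : β ∈ M.Psi) (hβ' : β' ∈ M.Psi) (horth : ⟪β, β'⟫ = 0) :
    (β + α ∈ M.Φ → β' + α ∉ M.Φ) ∧ (β - α ∈ M.Psi → β' - α ∉ M.Psi) := by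
  obtain ⟨f, hf⟩ := M.exists_coeff
  have hle : ∀ γ ∈ M.Φ, f γ ≤ 1 := fun _ => MRSD.coeff_le_one hf
  obtain ⟨hα, a, ha, ha0⟩ := hα
  obtain ⟨hβ, b, hb, hb1⟩ := hβ
  obtain ⟨hβ', b', hb', hb1'⟩ := hβ'
  have hfα : f α = 0 := by rw [ha, hf, ha0, Nat.cast_zero]
  have hfβ : f β = 1 := by rw [hb, hf, hb1, Nat.cast_one]
  have hfβ' : f β' = 1 := by rw [hb', hf, hb1', Nat.cast_one]
  have hnegα : -α ∈ M.Φ := by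
    have hne : ⟪α, α⟫ ≠ 0 := fun h => M.nonzero (inner_self_eq_zero.mp h ▸ hα)
    have h := M.reflClosed α hα α hα
    rwa [sref_apply, mul_div_cancel_right₀ _ hne, two_smul, sub_add_cancel_left] at h
  refine ⟨MRSD.add_notMem_of_inner_eq_zero hle hα hβ hβ' hfα hfβ hfβ' horth, fun h h' => ?_⟩
  exact MRSD.add_notMem_of_inner_eq_zero hle hnegα hβ hβ' (by rw [map_neg, hfα, neg_zero])
    hfβ hfβ' horth (sub_eq_add_neg β α ▸ h.1) (sub_eq_add_neg β' α ▸ h'.1)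
end
end

section
/- Let S ⊆ Ψ be an orthogonal subset. Then Φ_S = {α ∈ Φ : α = ½(±β ± β′) for some β, β′ ∈ S}. -/
open scoped RealInnerProductSpace
open Classical

noncomputable section

variable (V : Type) [NormedAddCommGroup V] [InnerProductSpace ℝ V]

variable {V}

variable (V)

lemma list_prod_sref_apply {V : Type} [NormedAddCommGroup V] [InnerProductSpace ℝ V]
    (l : List V) (hl : l.Pairwise fun a b => ⟪a, b⟫ = 0) (x : V) :
    (l.map (sref V)).prod x =
      x - (l.map fun β => (2 * ⟪x, β⟫ / ⟪β, β⟫) • β).sum := by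
  induction l with
  | nil => simp
  | cons a t ih =>
    rw [List.pairwise_cons] at hl
    have horth : ∀ u : List V, (∀ b ∈ u, ⟪a, b⟫ = 0) →
        ⟪(u.map fun β => (2 * ⟪x, β⟫ / ⟪β, β⟫) • β).sum, a⟫ = 0 := by
      intro u hu
      induction u with
      | nil => simp
      | cons b s ihs =>
        simp only [List.forall_mem_cons] at hu
        rw [List.map_cons, List.sum_cons, inner_add_left, ihs hu.2, real_inner_smul_left,
          real_inner_comm a b, hu.1, mul_zero, add_zero]
    simp only [List.map_cons, List.prod_cons, List.sum_cons, LinearEquiv.mul_apply]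
    rw [ih hl.2, sref_apply, inner_sub_left, horth t hl.1, sub_zero]
    abel

lemma sigmaOf_apply {V : Type} [NormedAddCommGroup V] [InnerProductSpace ℝ V]
    {S : Finset V} (hS : OrthSet S) (x : V) :
    sigmaOf S x = x - ∑ β ∈ S, (2 * ⟪x, β⟫ / ⟪β, β⟫) • β := by
  rw [sigmaOf, list_prod_sref_apply, Finset.sum_map_toList]
  refine S.nodup_toList.imp_of_mem ?_
  intro a b ha hb hab
  exact hS (by simpa using ha) (by simpa using hb) hab

lemma RSD.sigmaOf_mem {V : Type} [NormedAddCommGroup V] [InnerProductSpace ℝ V]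
    (D : RSD V) {S : Finset V} (hS : S ⊆ D.Φ) {α : V} (hα : α ∈ D.Φ) :
    sigmaOf S α ∈ D.Φ := by
  have key : ∀ l : List V, (∀ β ∈ l, β ∈ D.Φ) → (l.map (sref V)).prod α ∈ D.Φ := by
    intro l hl
    induction l with
    | nil => simpa using hα
    | cons a t ih =>
      simp only [List.forall_mem_cons] at hl
      simpa using D.reflClosed a hl.1 _ (ih hl.2)
  exact key _ fun β hβ => hS (by simpa using hβ)

lemma RSD.neg_mem {V : Type} [NormedAddCommGroup V] [InnerProductSpace ℝ V]
    (D : RSD V) {α : V} (hα : α ∈ D.Φ) : -α ∈ D.Φ := by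
  have h0 : (⟪α, α⟫ : ℝ) ≠ 0 := fun h => D.nonzero (inner_self_eq_zero.mp h ▸ hα)
  have h := D.reflClosed α hα α hα
  rw [sref_apply, mul_div_assoc, div_self h0, mul_one, two_smul] at h
  simpa using h

/-- The linear functional reading off the coefficient of the marked simple root. -/
lemma MRSD.exists_coeff_s14 {V : Type} [NormedAddCommGroup V] [InnerProductSpace ℝ V]
    (M : MRSD V) : ∃ h : V →ₗ[ℝ] ℝ, ∀ c : V → ℕ,
      h (∑ γ ∈ M.Δ, (c γ : ℝ) • γ) = c M.αP := by
  let b := Module.Basis.extend (show LinearIndepOn ℝ id (M.Δ : Set V) from M.Δ_indep)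
  have hmem : ∀ γ ∈ M.Δ, ∃ i, b i = γ := by
    intro γ hγ
    have hγ' : γ ∈ Set.range b := by
      rw [Module.Basis.range_extend]
      exact Module.Basis.subset_extend _ hγ
    exact hγ'
  refine ⟨b.constr ℝ fun i => if b i = M.αP then (1 : ℝ) else 0, fun c => ?_⟩
  rw [map_sum, Finset.sum_eq_single_of_mem M.αP M.αP_mem]
  · obtain ⟨i, hi⟩ := hmem _ M.αP_mem
    rw [← hi, map_smul, Module.Basis.constr_basis]
    simp [hi]
  · intro γ hγ hne
    obtain ⟨i, hi⟩ := hmem _ hγ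
    rw [← hi, map_smul, Module.Basis.constr_basis, if_neg (by rwa [hi]), smul_zero]

/-- In the cominuscule case, the coefficient of the marked simple root is `1` on `Ψ` and lies
in `[-1, 1]` on all roots. -/
lemma MRSD.exists_bounded_coeff {V : Type} [NormedAddCommGroup V] [InnerProductSpace ℝ V]
    (M : MRSD V) : ∃ h : V →ₗ[ℝ] ℝ, (∀ β ∈ M.Psi, h β = 1) ∧ ∀ α ∈ M.Φ, |h α| ≤ 1 := by
  obtain ⟨h, hh⟩ := M.exists_coeff_s14
  have hle : ∀ α ∈ M.Φ, h α ≤ 1 := by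
    intro α hα
    obtain ⟨c, hc⟩ := M.θ_high α hα
    obtain ⟨d, hd, hd1⟩ := M.θ_coeff
    have h1 : h (M.θ - α) = c M.αP := by rw [hc, hh]
    have h2 : h M.θ = 1 := by rw [hd, hh, hd1, Nat.cast_one]
    rw [map_sub, h2] at h1
    have : (0 : ℝ) ≤ c M.αP := Nat.cast_nonneg _
    linarith
  refine ⟨h, ?_, fun α hα => abs_le.mpr ⟨?_, hle α hα⟩⟩
  · rintro β ⟨-, c, hc, hc1⟩
    rw [hc, hh, hc1, Nat.cast_one]
  · have := hle _ (M.neg_mem hα)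
    rw [map_neg] at this
    linarith

/-- The Cartan integers of a root in `Φ_S` with respect to `S` have total size at most `2`. -/
lemma MRSD.sum_abs_cartan_le {V : Type} [NormedAddCommGroup V] [InnerProductSpace ℝ V]
    (M : MRSD V) {S : Finset V} (hS : (↑S : Set V) ⊆ M.Psi) (horth : OrthSet S)
    {α : V} (hα : α ∈ M.Φ) (n : V → ℝ) (hn : ∀ β ∈ S, n β = 2 * ⟪α, β⟫ / ⟪β, β⟫)
    (hsum : (2 : ℝ) • α = ∑ β ∈ S, n β • β) : ∑ β ∈ S, |n β| ≤ 2 := by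
  obtain ⟨h, h1, hle⟩ := M.exists_bounded_coeff
  have hval : ∀ T ⊆ S, h (∑ β ∈ T, n β • β) = ∑ β ∈ T, n β := by
    intro T hT
    rw [map_sum]
    refine Finset.sum_congr rfl fun β hβ => ?_
    rw [map_smul, h1 β (hS (hT hβ)), smul_eq_mul, mul_one]
  set T := S.filter fun β => 0 ≤ n β with hTdef
  have hT : T ⊆ S := Finset.filter_subset _ _
  have hTorth : OrthSet T := horth.mono (by exact_mod_cast hT)
  have hmem := hle _ (M.sigmaOf_mem (S := T) (fun β hβ => (hS (hT hβ)).1) hα)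
  rw [sigmaOf_apply hTorth, Finset.sum_congr rfl (fun β hβ => by rw [← hn β (hT hβ)]),
    map_sub, hval T hT, abs_le] at hmem
  have htwo : 2 * h α = ∑ β ∈ S, n β := by
    rw [← hval S subset_rfl, ← hsum, map_smul, smul_eq_mul]
  have habs : ∑ β ∈ S, |n β| = 2 * ∑ β ∈ T, n β - ∑ β ∈ S, n β := by
    rw [hTdef, Finset.sum_filter, Finset.mul_sum, ← Finset.sum_sub_distrib]
    refine Finset.sum_congr rfl fun β _ => ?_
    split_ifs with hb
    · rw [abs_of_nonneg hb]; ring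
    · rw [abs_of_neg (not_le.mp hb)]; ring
  linarith [hmem.1]

/-- Let `S ⊆ Ψ` be an orthogonal subset.  Then
`Φ_S = {α ∈ Φ : α = ½(±β ± β') for some β, β' ∈ S}`. -/
theorem statement14 {V : Type} [NormedAddCommGroup V] [InnerProductSpace ℝ V]
    [FiniteDimensional ℝ V]
    (M : MRSD V) (S : Finset V)
    (hS : (↑S : Set V) ⊆ M.Psi) (horth : OrthSet S) :
    M.PhiSet S = {α : V | α ∈ M.Φ ∧ ∃ β ∈ S, ∃ β' ∈ S, ∃ ε ε' : ℝ,
      (ε = 1 ∨ ε = -1) ∧ (ε' = 1 ∨ ε' = -1) ∧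
      α = (1 / 2 : ℝ) • (ε • β + ε' • β')} := by
  have hΦ : ∀ β ∈ S, β ∈ M.Φ := fun β hβ => (hS hβ).1
  have hne : ∀ β ∈ S, (⟪β, β⟫ : ℝ) ≠ 0 := fun β hβ h =>
    M.nonzero (inner_self_eq_zero.mp h ▸ hΦ β hβ)
  ext α
  constructor
  · rintro ⟨hα, hσ⟩
    refine ⟨hα, ?_⟩
    have hint : ∀ β, ∃ n : ℤ, β ∈ S → (n : ℝ) = 2 * ⟪α, β⟫ / ⟪β, β⟫ := by
      intro β
      by_cases hβ : β ∈ S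
      · obtain ⟨n, hn⟩ := M.crystal β (hΦ β hβ) α hα
        exact ⟨n, fun _ => hn⟩
      · exact ⟨0, fun h => absurd h hβ⟩
    choose n hn using hint
    have hsum : (2 : ℝ) • α = ∑ β ∈ S, (n β : ℝ) • β := by
      rw [sigmaOf_apply horth, Finset.sum_congr rfl (fun β hβ => by rw [← hn β hβ]),
        sub_eq_iff_eq_add] at hσ
      rw [two_smul]
      nth_rewrite 1 [hσ]
      abel
    have hbound : ∑ β ∈ S, |n β| ≤ 2 := by
      exact_mod_cast M.sum_abs_cartan_le hS horth hα (fun β => (n β : ℝ)) hn hsum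
    have hhalf : α = (1 / 2 : ℝ) • ∑ β ∈ S, (n β : ℝ) • β := by
      rw [← hsum, smul_smul]; norm_num
    have hα0 : α ≠ 0 := fun h => M.nonzero (h ▸ hα)
    obtain ⟨β, hβ, hnβ⟩ : ∃ β ∈ S, n β ≠ 0 := by
      by_contra! hcon
      refine hα0 ?_
      rw [hhalf, Finset.sum_eq_zero fun β hβ => by rw [hcon β hβ]; simp, smul_zero]
    by_cases hex : ∃ β' ∈ S, β' ≠ β ∧ n β' ≠ 0
    · obtain ⟨β', hβ', hββ', hnβ'⟩ := hex
      have hmem' : β' ∈ S.erase β := Finset.mem_erase.mpr ⟨hββ', hβ'⟩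
      have hsplit : ∀ {A : Type} [AddCommGroup A] (f : V → A),
          ∑ x ∈ S, f x = f β + (f β' + ∑ x ∈ (S.erase β).erase β', f x) := by
        intro A _ f
        rw [Finset.add_sum_erase _ _ hmem', Finset.add_sum_erase _ _ hβ]
      rw [hsplit] at hbound
      have hpos := Int.one_le_abs hnβ
      have hpos' := Int.one_le_abs hnβ'
      have hrest : ∀ x ∈ (S.erase β).erase β', n x = 0 := by
        intro x hx
        have := Finset.single_le_sum (f := fun x => |n x|) (fun y _ => abs_nonneg _) hx
        exact abs_nonpos_iff.mp (by linarith)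
      have hnn : 0 ≤ ∑ x ∈ (S.erase β).erase β', |n x| :=
        Finset.sum_nonneg fun y _ => abs_nonneg _
      have hunit : ∀ m : ℤ, |m| = 1 → (m : ℝ) = 1 ∨ (m : ℝ) = -1 := by
        intro m hm
        rcases eq_or_eq_neg_of_abs_eq hm with h | h <;> simp [h]
      refine ⟨β, hβ, β', hβ', n β, n β', hunit _ (by linarith), hunit _ (by linarith), ?_⟩
      rw [hhalf, hsplit, Finset.sum_eq_zero (s := (S.erase β).erase β')
        fun x hx => by rw [hrest x hx]; simp, add_zero]
    · push Not at hex
      have hsingle : α = ((n β : ℝ) / 2) • β := by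
        rw [hhalf, Finset.sum_eq_single_of_mem β hβ fun x hx hxβ => by simp [hex x hx hxβ],
          smul_smul]
        congr 1
        ring
      have hunit := M.reduced β (hΦ β hβ) _ (hsingle ▸ hα)
      refine ⟨β, hβ, β, hβ, (n β : ℝ) / 2, (n β : ℝ) / 2, hunit, hunit, ?_⟩
      rw [← hsingle, ← two_smul ℝ α, smul_smul]
      norm_num
  · rintro ⟨hα, β, hβ, β', hβ', ε, ε', -, -, rfl⟩
    have hneg : ∀ β ∈ S, sigmaOf S β = -β := by
      intro β hβ
      rw [sigmaOf_apply horth, Finset.sum_eq_single_of_mem β hβ]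
      · rw [mul_div_assoc, div_self (hne β hβ), mul_one, two_smul]
        abel
      · intro γ hγ hγβ
        rw [horth hβ hγ hγβ.symm]
        simp
    refine ⟨hα, ?_⟩
    rw [map_smul, map_add, map_smul, map_smul, hneg β hβ, hneg β' hβ']
    simp only [smul_neg, smul_add, neg_add]
end
end

section
/- Let (u,R) be an admissible pair. Then [u σ_R]^P ≤ u in the Bruhat order, where [w]^P denotes the minimal-length representative of the coset wW_P. -/
open scoped RealInnerProductSpace
open Classical

noncomputable section

variable (V : Type) [NormedAddCommGroup V] [InnerProductSpace ℝ V]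

variable {V}

variable (V)

section Reflections

variable {V : Type} [NormedAddCommGroup V] [InnerProductSpace ℝ V]

lemma sref_mul_self (a : V) : sref V a * sref V a = 1 :=
  LinearEquiv.ext fun x => reflMap_involutive V a x

lemma sref_self (a : V) : sref V a a = -a := by
  by_cases h : a = 0
  · simp [h]
  · have h' : (⟪a, a⟫ : ℝ) ≠ 0 := inner_self_ne_zero.mpr h
    rw [sref_apply, mul_div_assoc, div_self h']
    module

lemma sref_of_orthogonal {a x : V} (h : (⟪x, a⟫ : ℝ) = 0) : sref V a x = x := by
  simp [sref_apply, h]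

lemma inner_sref_sref (a x y : V) : (⟪sref V a x, sref V a y⟫ : ℝ) = ⟪x, y⟫ := by
  by_cases h : a = 0
  · simp [sref_apply, h]
  · have h' : (⟪a, a⟫ : ℝ) ≠ 0 := inner_self_ne_zero.mpr h
    simp only [sref_apply, inner_sub_left, inner_sub_right, real_inner_smul_left,
      real_inner_smul_right, real_inner_comm a y, real_inner_comm a x]
    rw [real_inner_comm y a]
    field_simp
    ring

lemma mul_sref_of_isometry {g : V ≃ₗ[ℝ] V} (hg : ∀ x y, (⟪g x, g y⟫ : ℝ) = ⟪x, y⟫) (b : V) :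
    g * sref V b = sref V (g b) * g := by
  ext x
  simp only [LinearEquiv.mul_apply, sref_apply, map_sub, map_smul, hg]

end Reflections

namespace RSD

variable {V : Type} [NormedAddCommGroup V] [InnerProductSpace ℝ V] (D : RSD V)

lemma inner_apply_of_mem_W {g : V ≃ₗ[ℝ] V} (hg : g ∈ D.W) :
    ∀ x y, (⟪g x, g y⟫ : ℝ) = ⟪x, y⟫ := by
  induction hg using Subgroup.closure_induction with
  | mem g h =>
    obtain ⟨a, -, rfl⟩ := h
    exact inner_sref_sref a
  | one => simp
  | mul g k _ _ ihg ihk => intro x y; rw [LinearEquiv.mul_apply, LinearEquiv.mul_apply, ihg, ihk]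
  | inv g _ ih =>
    intro x y
    rw [← ih]
    simp

lemma prod_mem_closure {S : Set V} {l : List V} (hl : ∀ γ ∈ l, γ ∈ S) :
    (l.map (sref V)).prod ∈ Subgroup.closure ((fun γ => sref V γ) '' S) :=
  Subgroup.list_prod_mem _ fun g hg => by
    obtain ⟨a, ha, rfl⟩ := List.mem_map.mp hg
    exact Subgroup.subset_closure ⟨a, hl a ha, rfl⟩

lemma exists_list_of_mem_closure {S : Set V} {g : V ≃ₗ[ℝ] V}
    (hg : g ∈ Subgroup.closure ((fun γ => sref V γ) '' S)) :
    ∃ l : List V, (∀ γ ∈ l, γ ∈ S) ∧ g = (l.map (sref V)).prod := by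
  induction hg using Subgroup.closure_induction with
  | mem g h =>
    obtain ⟨a, ha, rfl⟩ := h
    exact ⟨[a], by simpa using ha, by simp⟩
  | one => exact ⟨[], by simp, by simp⟩
  | mul g k _ _ ihg ihk =>
    obtain ⟨l, hl, rfl⟩ := ihg
    obtain ⟨m, hm, rfl⟩ := ihk
    refine ⟨l ++ m, fun γ h => ?_, by simp⟩
    rcases List.mem_append.mp h with h | h
    exacts [hl γ h, hm γ h]
  | inv g _ ih =>
    obtain ⟨l, hl, rfl⟩ := ih
    refine ⟨l.reverse, by simpa using hl, ?_⟩
    rw [List.prod_inv_reverse, List.map_map, List.map_reverse]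
    congr 2

lemma prod_mem_W {l : List V} (hl : ∀ γ ∈ l, γ ∈ D.Δ) : (l.map (sref V)).prod ∈ D.W :=
  prod_mem_closure hl

lemma length_le_of_word {l : List V} (hl : ∀ γ ∈ l, γ ∈ D.Δ) :
    D.length (l.map (sref V)).prod ≤ l.length :=
  Nat.sInf_le ⟨l, rfl, hl, rfl⟩

lemma exists_reduced_word {g : V ≃ₗ[ℝ] V} (hg : g ∈ D.W) :
    ∃ l : List V, l.length = D.length g ∧ (∀ γ ∈ l, γ ∈ D.Δ) ∧ g = (l.map (sref V)).prod := by
  obtain ⟨l, hl, h⟩ := exists_list_of_mem_closure hg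
  exact Nat.sInf_mem (s := {n | ∃ l : List V, l.length = n ∧ (∀ γ ∈ l, γ ∈ D.Δ) ∧
    g = (l.map (sref V)).prod}) ⟨_, l, rfl, hl, h⟩

lemma apply_mem_Φ {g : V ≃ₗ[ℝ] V} (hg : g ∈ D.W) : ∀ x ∈ D.Φ, g x ∈ D.Φ := by
  obtain ⟨l, hl, rfl⟩ := exists_list_of_mem_closure hg
  induction l with
  | nil => simp
  | cons a t ih =>
    simp only [List.mem_cons, forall_eq_or_imp] at hl
    intro x hx
    rw [List.map_cons, List.prod_cons, LinearEquiv.mul_apply]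
    exact D.reflClosed a (D.Δ_sub hl.1) _ (ih hl.2 (D.prod_mem_W hl.2) x hx)

lemma neg_mem_Φ {x : V} (hx : x ∈ D.Φ) : -x ∈ D.Φ := by
  simpa [sref_self] using D.reflClosed x hx x hx

lemma mem_Pos_or_mem_Neg {x : V} (hx : x ∈ D.Φ) : x ∈ D.Pos ∨ x ∈ D.Neg :=
  (D.Δ_base x hx).imp (fun h => ⟨hx, h⟩) fun h => ⟨D.neg_mem_Φ hx, h⟩

lemma simple_mem_Pos {a : V} (ha : a ∈ D.Δ) : a ∈ D.Pos :=
  ⟨D.Δ_sub ha, fun γ => if γ = a then 1 else 0, by simp [ha]⟩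

lemma neg_mem_Neg {x : V} (hx : x ∈ D.Pos) : -x ∈ D.Neg := by
  simpa [Neg] using hx

lemma mem_Φ_of_mem_Neg {x : V} (hx : x ∈ D.Neg) : x ∈ D.Φ := by
  simpa using D.neg_mem_Φ hx.1

lemma eq_zero_of_sum_eq_zero {c : V → ℝ} (h : ∑ γ ∈ D.Δ, c γ • γ = 0) :
    ∀ γ ∈ D.Δ, c γ = 0 := by
  have hi := D.Δ_indep
  intro γ hγ
  have := Fintype.linearIndependent_iff.mp hi (fun x => c x)
    (by rw [← h]; exact Finset.sum_coe_sort D.Δ fun γ => c γ • γ) ⟨γ, hγ⟩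
  exact this

/-- A simple reflection permutes the positive roots other than the simple root itself. -/
lemma eq_simple_of_sref_mem_Neg {a x : V} (ha : a ∈ D.Δ) (hx : x ∈ D.Pos)
    (h : sref V a x ∈ D.Neg) : x = a := by
  obtain ⟨hxΦ, c, hc⟩ := hx
  obtain ⟨-, d, hd⟩ := h
  set k : ℝ := 2 * ⟪x, a⟫ / ⟪a, a⟫ with hk
  have hsum : ∑ γ ∈ D.Δ, ((c γ : ℝ) + d γ - if γ = a then k else 0) • γ = 0 := by
    simp only [sub_smul, add_smul, Finset.sum_sub_distrib, Finset.sum_add_distrib, ← hc, ← hd,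
      ite_smul, zero_smul, Finset.sum_ite_eq', ha, if_true, sref_apply, ← hk]
    abel
  have hz := D.eq_zero_of_sum_eq_zero hsum
  have hx' : x = (c a : ℝ) • a := by
    rw [hc]
    refine Finset.sum_eq_single_of_mem a ha fun γ hγ hne => ?_
    have h0 := hz γ hγ
    rw [if_neg hne, sub_zero] at h0
    have : c γ + d γ = 0 := by exact_mod_cast h0
    simp [Nat.eq_zero_of_add_eq_zero_right this]
  rcases D.reduced a (D.Δ_sub ha) (c a) (hx' ▸ hxΦ) with h1 | h1
  · rw [hx', h1, one_smul]
  · have : (0 : ℝ) ≤ c a := Nat.cast_nonneg _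
    linarith

/-- The strong exchange property for words in a set of simple roots. -/
lemma exists_shorter_word {S : Set V} (hS : S ⊆ D.Δ) {b : V} (hb : b ∈ D.Pos) (l : List V)
    (hl : ∀ γ ∈ l, γ ∈ S) (h : (l.map (sref V)).prod b ∈ D.Neg) :
    ∃ l' : List V, l'.length < l.length ∧ (∀ γ ∈ l', γ ∈ S) ∧
      (l'.map (sref V)).prod = (l.map (sref V)).prod * sref V b := by
  induction l with
  | nil =>
    exfalso
    obtain ⟨hbΦ, c, hc⟩ := hb
    obtain ⟨-, d, hd⟩ := h
    have hsum : ∑ γ ∈ D.Δ, ((c γ : ℝ) + d γ) • γ = 0 := by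
      simp only [add_smul, Finset.sum_add_distrib, ← hc, ← hd]
      simp
    have hz := D.eq_zero_of_sum_eq_zero hsum
    refine D.nonzero ?_
    have : b = 0 := by
      rw [hc]
      refine Finset.sum_eq_zero fun γ hγ => ?_
      have : c γ + d γ = 0 := by exact_mod_cast hz γ hγ
      simp [Nat.eq_zero_of_add_eq_zero_right this]
    exact this ▸ hbΦ
  | cons a t ih =>
    simp only [List.mem_cons, forall_eq_or_imp] at hl
    have htW : (t.map (sref V)).prod ∈ D.W := D.prod_mem_W fun γ hγ => hS (hl.2 γ hγ)
    rcases D.mem_Pos_or_mem_Neg (D.apply_mem_Φ htW b hb.1) with hp | hn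
    · have hta : (t.map (sref V)).prod b = a :=
        D.eq_simple_of_sref_mem_Neg (hS hl.1) hp (by simpa [LinearEquiv.mul_apply] using h)
      refine ⟨t, by simp, hl.2, ?_⟩
      rw [List.map_cons, List.prod_cons, mul_assoc,
        mul_sref_of_isometry (D.inner_apply_of_mem_W htW), hta, ← mul_assoc, sref_mul_self,
        one_mul]
    · obtain ⟨t', hlen, ht', hprod⟩ := ih hl.2 hn
      refine ⟨a :: t', by simpa using hlen, ?_, by simp [hprod, mul_assoc]⟩
      simpa using ⟨hl.1, ht'⟩

lemma mul_sref_mem_W_and_length_lt {w : V ≃ₗ[ℝ] V} (hw : w ∈ D.W) {b : V} (hb : b ∈ D.Pos)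
    (h : w b ∈ D.Neg) : w * sref V b ∈ D.W ∧ D.length (w * sref V b) < D.length w := by
  obtain ⟨l, hlen, hl, rfl⟩ := D.exists_reduced_word hw
  obtain ⟨l', hlen', hl', hprod⟩ := D.exists_shorter_word (S := D.Δ) subset_rfl hb l hl h
  rw [← hprod, ← hlen]
  exact ⟨D.prod_mem_W hl', (D.length_le_of_word hl').trans_lt hlen'⟩

lemma ble_mul_sref {w : V ≃ₗ[ℝ] V} (hw : w ∈ D.W) {b : V} (hb : b ∈ D.Pos)
    (h : w b ∈ D.Neg) : D.ble (w * sref V b) w := by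
  refine Relation.ReflTransGen.single ⟨⟨w b, D.mem_Φ_of_mem_Neg h, ?_⟩,
    (D.mul_sref_mem_W_and_length_lt hw hb h).2⟩
  rw [← mul_assoc, ← mul_sref_of_isometry (D.inner_apply_of_mem_W hw), mul_assoc, sref_mul_self,
    mul_one]

lemma ble_mul_prod_of_orthogonal {L : List V} (hnd : L.Nodup) (hpos : ∀ b ∈ L, b ∈ D.Pos)
    (horth : ∀ a ∈ L, ∀ b ∈ L, a ≠ b → (⟪a, b⟫ : ℝ) = 0) {w : V ≃ₗ[ℝ] V} (hw : w ∈ D.W)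
    (hneg : ∀ b ∈ L, w b ∈ D.Neg) : D.ble (w * (L.map (sref V)).prod) w := by
  induction L generalizing w with
  | nil => rw [List.map_nil, List.prod_nil, mul_one]; exact Relation.ReflTransGen.refl
  | cons a t ih =>
    have ha : a ∈ a :: t := List.mem_cons_self
    have hat := (List.nodup_cons.mp hnd).1
    rw [List.map_cons, List.prod_cons, ← mul_assoc]
    refine Relation.ReflTransGen.trans (ih (List.nodup_cons.mp hnd).2
      (fun b hb => hpos b (List.mem_cons_of_mem _ hb))
      (fun b hb c hc => horth b (List.mem_cons_of_mem _ hb) c (List.mem_cons_of_mem _ hc))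
      (D.mul_sref_mem_W_and_length_lt hw (hpos a ha) (hneg a ha)).1 fun b hb => ?_)
      (D.ble_mul_sref hw (hpos a ha) (hneg a ha))
    rw [LinearEquiv.mul_apply, sref_of_orthogonal
      (horth b (List.mem_cons_of_mem _ hb) a ha fun e => hat (e ▸ hb))]
    exact hneg b (List.mem_cons_of_mem _ hb)

/-- An element of minimal length in its coset modulo the subgroup generated by a set of simple
reflections is below every element of that coset. -/
lemma ble_mul_of_length_minimal {S : Set V} (hS : S ⊆ D.Δ) {μ : V ≃ₗ[ℝ] V} (hμ : μ ∈ D.W)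
    (hmin : ∀ v ∈ Subgroup.closure ((fun γ => sref V γ) '' S), D.length μ ≤ D.length (μ * v))
    (l : List V) (hl : ∀ γ ∈ l, γ ∈ S) : D.ble μ (μ * (l.map (sref V)).prod) := by
  induction hn : l.length using Nat.strong_induction_on generalizing l with
  | _ n ih =>
    rcases List.eq_nil_or_concat l with rfl | ⟨t, γ, rfl⟩
    · rw [List.map_nil, List.prod_nil, mul_one]; exact Relation.ReflTransGen.refl
    rw [List.concat_eq_append] at hl hn ⊢
    have ht : ∀ δ ∈ t, δ ∈ S := fun δ hδ => hl δ (by simp [hδ])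
    have hγ : γ ∈ S := hl γ (by simp)
    have hγpos := D.simple_mem_Pos (hS hγ)
    have htS := prod_mem_closure ht
    have htW : (t.map (sref V)).prod ∈ D.W := D.prod_mem_W fun δ hδ => hS (ht δ hδ)
    have hsγ : sref V γ ∈ Subgroup.closure ((fun γ => sref V γ) '' S) :=
      Subgroup.subset_closure ⟨γ, hγ, rfl⟩
    have hsγW : sref V γ ∈ D.W := Subgroup.subset_closure ⟨γ, hS hγ, rfl⟩
    simp only [List.length_append, List.length_singleton] at hn
    simp only [List.map_append, List.prod_append, List.map_singleton, List.prod_singleton]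
    set v := (t.map (sref V)).prod with hv
    rcases D.mem_Pos_or_mem_Neg (D.apply_mem_Φ htW γ hγpos.1) with hp | hneg
    · rcases D.mem_Pos_or_mem_Neg (D.apply_mem_Φ hμ _ hp.1) with hp' | hneg'
      · refine Relation.ReflTransGen.trans (ih t.length (by omega) t ht rfl) ?_
        have := D.ble_mul_sref (mul_mem hμ (mul_mem htW hsγW)) hγpos
          (by simpa [LinearEquiv.mul_apply, sref_self] using D.neg_mem_Neg hp')
        rwa [← mul_assoc μ, mul_assoc (μ * v), sref_mul_self, mul_one] at this
      · have hlt := (D.mul_sref_mem_W_and_length_lt hμ hp hneg').2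
        have hconj : sref V (v γ) = v * sref V γ * v⁻¹ := by
          rw [mul_sref_of_isometry (D.inner_apply_of_mem_W htW), mul_inv_cancel_right]
        exact absurd hlt (not_lt.mpr (hmin _
          (hconj ▸ mul_mem (mul_mem htS hsγ) (inv_mem htS))))
    · obtain ⟨t', hlen, ht', hprod⟩ := D.exists_shorter_word hS hγpos t ht hneg
      rw [hv, ← hprod]
      exact ih t'.length (by omega) t' ht' rfl

end RSD

/-- Let `(u,R)` be an admissible pair.  Then `[u σ_R]^P ≤ u` in the Bruhat
order, where `[w]^P` is the minimal-length representative of the coset `w W_P`. -/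
theorem statement18 {V : Type} [NormedAddCommGroup V] [InnerProductSpace ℝ V]
    [FiniteDimensional ℝ V]
    (M : MRSD V) (u : V ≃ₗ[ℝ] V) (R : Finset V) (h : M.Admissible u R) :
    ∀ μ : V ≃ₗ[ℝ] V, M.IsMinRepOf μ (u * sigmaOf R) → M.ble μ u := by
  intro μ hμ
  obtain ⟨⟨huW, -⟩, hPsi, horth, hneg⟩ := h
  obtain ⟨⟨hμW, hcoset⟩, hmin⟩ := hμ
  refine Relation.ReflTransGen.trans (b := u * sigmaOf R) ?_
    (M.toRSD.ble_mul_prod_of_orthogonal R.nodup_toList ?_ ?_ huW ?_)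
  · obtain ⟨l, hl, hprod⟩ := RSD.exists_list_of_mem_closure (inv_mem hcoset)
    have heq : u * sigmaOf R = μ * (l.map (sref V)).prod := by rw [← hprod]; group
    have hS : (↑(M.Δ.erase M.αP) : Set V) ⊆ M.Δ := Finset.coe_subset.mpr (M.Δ.erase_subset _)
    rw [heq]
    refine M.toRSD.ble_mul_of_length_minimal hS hμW (fun v hv => hmin _ ?_ ?_) l hl
    · exact mul_mem hμW (Subgroup.closure_mono (Set.image_mono hS) hv)
    · rw [← mul_assoc]
      exact mul_mem hcoset hv
  · intro b hb
    obtain ⟨hΦ, c, hc, -⟩ := hPsi (by simpa using hb)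
    exact ⟨hΦ, c, hc⟩
  · intro a ha b hb hab
    exact horth (by simpa using ha) (by simpa using hb) hab
  · intro b hb
    exact hneg b (by simpa using hb)
end
end
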